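/- Let n ≥ 1 and p > n+1 be integers and let S be an n×n complex Hermitian positive-definite matrix. Then ∫_{ℂ^n} ‖u‖² (1 + u^* S^{-2} u)^{-p} du = C_{n,p} · |det S|² · tr(S²)/(p−n−1), where C_{n,p} = π^n (p−n−1)!/(p−1)! and ‖u‖² = ∑_i |u_i|². -/

import Mathlib

open MeasureTheory Real Matrix
open scoped ComplexOrder

/-- Gaussian integral over the complex plane. -/
lemma aux_gauss (t : ℝ) (ht : 0 < t) : ∫ z : ℂ, rexp (-t * ‖z‖ ^ 2) = π * t⁻¹ := by
  have h := Complex.integral_exp_neg_mul_rpow (p := 2) (b := t) (by norm_num) ht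
  rw [show (-2 / 2 : ℝ) = -1 by norm_num, Real.rpow_neg_one,
    show (2 / 2 + 1 : ℝ) = 1 + 1 by norm_num, Real.Gamma_add_one one_ne_zero, Real.Gamma_one] at h
  simpa using h

/-- Second moment of the complex Gaussian. -/
lemma aux_gauss_sq (t : ℝ) (ht : 0 < t) :
    ∫ z : ℂ, ‖z‖ ^ 2 * rexp (-t * ‖z‖ ^ 2) = π * t⁻¹ ^ 2 := by
  have h := Complex.integral_rpow_mul_exp_neg_mul_rpow (p := 2) (q := 2) (b := t)
    (by norm_num) (by norm_num) ht
  rw [show (-(2 + 2) / 2 : ℝ) = -(2 : ℕ) by norm_num, Real.rpow_neg ht.le, Real.rpow_natCast,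
    show ((2 + 2) / 2 : ℝ) = 1 + 1 by norm_num, Real.Gamma_add_one one_ne_zero, Real.Gamma_one] at h
  simpa using h

/-- The factors of the product density. -/
noncomputable def auxF {n : ℕ} (i : Fin n) (t : ℝ) (j : Fin n) (z : ℂ) : ℝ :=
  (if j = i then ‖z‖ ^ 2 else 1) * rexp (-t * ‖z‖ ^ 2)

lemma auxF_integral {n : ℕ} (i j : Fin n) (t : ℝ) (ht : 0 < t) :
    ∫ z, auxF i t j z = π * t⁻¹ * (if j = i then t⁻¹ else 1) := by
  unfold auxF
  split_ifs
  · rw [aux_gauss_sq t ht]; ring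
  · simp only [one_mul, mul_one]; exact aux_gauss t ht

lemma auxF_integrable {n : ℕ} (i j : Fin n) (t : ℝ) (ht : 0 < t) :
    Integrable (auxF i t j) := by
  refine Integrable.of_integral_ne_zero ?_
  rw [auxF_integral i j t ht]
  have := Real.pi_pos
  split_ifs <;> positivity

lemma auxF_prod {n : ℕ} (i : Fin n) (t : ℝ) (v : Fin n → ℂ) :
    ∏ j, auxF i t j (v j) = ‖v i‖ ^ 2 * rexp (-t * ∑ j, ‖v j‖ ^ 2) := by
  unfold auxF
  rw [Finset.prod_mul_distrib, ← Real.exp_sum, Finset.mul_sum]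
  simp

lemma aux_gauss_n {n : ℕ} (i : Fin n) (t : ℝ) (ht : 0 < t) :
    Integrable (fun v : Fin n → ℂ => ‖v i‖ ^ 2 * rexp (-t * ∑ j, ‖v j‖ ^ 2)) ∧
    ∫ v : Fin n → ℂ, ‖v i‖ ^ 2 * rexp (-t * ∑ j, ‖v j‖ ^ 2) = π ^ n * t⁻¹ ^ (n + 1) := by
  simp_rw [← auxF_prod]
  constructor
  · exact Integrable.fintype_prod (f := fun j => auxF i t j) (fun j => auxF_integrable i j t ht)
  · rw [integral_fintype_prod_volume_eq_prod (fun j => auxF i t j)]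
    simp_rw [auxF_integral i _ t ht]
    rw [Finset.prod_mul_distrib]
    simp
    ring

lemma aux_gamma (m : ℕ) (r : ℝ) (hr : 0 < r) :
    ∫ t in Set.Ioi (0 : ℝ), t ^ m * rexp (-(r * t)) = (Nat.factorial m) * (r ^ (m + 1))⁻¹ := by
  have h := Real.integral_rpow_mul_exp_neg_mul_Ioi (a := m + 1) (r := r) (by positivity) hr
  rw [Real.Gamma_nat_eq_factorial] at h
  have e : ((m : ℝ) + 1) = ((m + 1 : ℕ) : ℝ) := by push_cast; ring
  rw [add_sub_cancel_right, e, Real.rpow_natCast] at h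
  simp_rw [Real.rpow_natCast] at h
  rw [h, one_div, inv_pow]; ring

/-- The radial integral. -/
lemma aux_main {n : ℕ} (i : Fin n) (k : ℕ) :
    Integrable (fun v : Fin n → ℂ => ‖v i‖ ^ 2 * ((1 + ∑ j, ‖v j‖ ^ 2) ^ (n + k + 2))⁻¹) ∧
    ∫ v : Fin n → ℂ, ‖v i‖ ^ 2 * ((1 + ∑ j, ‖v j‖ ^ 2) ^ (n + k + 2))⁻¹
      = π ^ n * (Nat.factorial k) / (Nat.factorial (n + k + 1)) := by
  set F : (Fin n → ℂ) → ℝ → ℝ := fun v t =>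
    t ^ (n + k + 1) * rexp (-t) * (‖v i‖ ^ 2 * rexp (-t * ∑ j, ‖v j‖ ^ 2)) with hF
  have hv : ∀ t ∈ Set.Ioi (0 : ℝ), ∫ v, F v t = π ^ n * (t ^ k * rexp (-(1 * t))) := by
    intro t ht
    have ht' : (0 : ℝ) < t := ht
    simp only [hF]
    rw [integral_const_mul, (aux_gauss_n i t ht).2, one_mul]
    rw [show n + k + 1 = k + (n + 1) by ring, pow_add, inv_pow]
    field_simp
  have ht : ∀ v, ∫ t in Set.Ioi (0 : ℝ), F v t = (Nat.factorial (n + k + 1)) *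
      (‖v i‖ ^ 2 * ((1 + ∑ j, ‖v j‖ ^ 2) ^ (n + k + 2))⁻¹) := by
    intro v
    have hpos : 0 < 1 + ∑ j, ‖v j‖ ^ 2 := by positivity
    have h := aux_gamma (n + k + 1) _ hpos
    have e : ∀ t, F v t = ‖v i‖ ^ 2 * (t ^ (n + k + 1) * rexp (-((1 + ∑ j, ‖v j‖ ^ 2) * t))) := by
      intro t
      simp only [hF]
      rw [show -((1 + ∑ j, ‖v j‖ ^ 2) * t) = -t + -t * ∑ j, ‖v j‖ ^ 2 by ring, Real.exp_add]
      ring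
    simp_rw [e]
    rw [integral_const_mul, h]; ring
  have hcont : Continuous (Function.uncurry F) := by
    simp only [hF, Function.uncurry_def]
    fun_prop
  have hint : Integrable (Function.uncurry F)
      ((volume : Measure (Fin n → ℂ)).prod (volume.restrict (Set.Ioi (0 : ℝ)))) := by
    rw [integrable_prod_iff' hcont.aestronglyMeasurable]
    constructor
    · filter_upwards [ae_restrict_mem measurableSet_Ioi] with t ht
      exact (aux_gauss_n i t ht).1.const_mul (t ^ (n + k + 1) * rexp (-t))
    · have hI : Integrable (fun t : ℝ => π ^ n * (t ^ k * rexp (-(1 * t))))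
          (volume.restrict (Set.Ioi (0 : ℝ))) := by
        refine Integrable.const_mul (Integrable.of_integral_ne_zero ?_) _
        rw [aux_gamma k 1 one_pos]
        positivity
      refine hI.congr ?_
      filter_upwards [ae_restrict_mem measurableSet_Ioi] with t ht
      rw [← hv t ht]
      refine integral_congr_ae (Filter.Eventually.of_forall fun v => ?_)
      have ht' : (0 : ℝ) < t := ht
      have : 0 ≤ F v t := by simp only [hF]; positivity
      simp [Function.uncurry, abs_of_nonneg this]
  have hfac : ((Nat.factorial (n + k + 1) : ℕ) : ℝ) ≠ 0 := by positivity
  have hswap := integral_integral_swap hint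
  have hleft := hint.integral_prod_left
  simp only [Function.uncurry] at hleft
  simp_rw [ht] at hswap hleft
  constructor
  · have := hleft.const_mul ((Nat.factorial (n + k + 1) : ℕ) : ℝ)⁻¹
    simpa [← mul_assoc, hfac] using this
  · rw [setIntegral_congr_fun measurableSet_Ioi hv, integral_const_mul, integral_const_mul,
      aux_gamma k 1 one_pos] at hswap
    rw [eq_div_iff hfac, mul_comm, hswap]
    simp

/-- Linear change of variables on `ℂⁿ`. -/
lemma aux_cov {n : ℕ} (T : Matrix (Fin n) (Fin n) ℂ) (hT : T.det ≠ 0) (f : (Fin n → ℂ) → ℝ) :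
    ∫ u, f u = ‖T.det‖ ^ 2 * ∫ v, f (T *ᵥ v) := by
  set L : (Fin n → ℂ) →ₗ[ℝ] (Fin n → ℂ) := (Matrix.toLin' T).restrictScalars ℝ with hL
  have hdet : LinearMap.det L = ‖T.det‖ ^ 2 := by
    rw [hL, LinearMap.det_restrictScalars, LinearMap.det_toLin', Algebra.norm_complex_apply,
      Complex.normSq_eq_norm_sq]
  have hpos : 0 < ‖T.det‖ ^ 2 := by positivity
  have hne : LinearMap.det L ≠ 0 := by rw [hdet]; exact hpos.ne'
  have hmap := Measure.map_linearMap_addHaar_eq_smul_addHaar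
    (volume : Measure (Fin n → ℂ)) hne
  have hemb : MeasurableEmbedding L :=
    (L.equivOfDetNeZero hne).toContinuousLinearEquiv.toHomeomorph.toMeasurableEquiv.measurableEmbedding
  have h := hemb.integral_map (μ := volume) f
  rw [hmap, integral_smul_measure, hdet, ENNReal.toReal_ofReal (abs_nonneg _),
    abs_of_pos (inv_pos.2 hpos)] at h
  change _ = ∫ v, f (T *ᵥ v) at h
  rw [← h, smul_eq_mul, mul_inv_cancel_left₀ hpos.ne']

/-- Consequence of the spectral theorem. -/
lemma aux_spec {n : ℕ} (S : Matrix (Fin n) (Fin n) ℂ) (hS : S.PosDef) :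
    ∃ (T : Matrix (Fin n) (Fin n) ℂ) (d : Fin n → ℝ),
      S ^ 2 = T * Tᴴ ∧ Tᴴ * T = diagonal (fun i => (d i : ℂ)) := by
  set U : Matrix (Fin n) (Fin n) ℂ := (hS.1.eigenvectorUnitary : Matrix (Fin n) (Fin n) ℂ) with hU
  set e := hS.1.eigenvalues
  set D : Matrix (Fin n) (Fin n) ℂ := diagonal (fun i => (e i : ℂ)) with hD
  have hUU : Uᴴ * U = 1 := Unitary.coe_star_mul_self hS.1.eigenvectorUnitary
  have hsp : S = U * D * Uᴴ := by
    have := hS.1.spectral_theorem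
    rw [Unitary.conjStarAlgAut_apply] at this
    exact this
  have hDH : Dᴴ = D := by
    rw [hD, diagonal_conjTranspose]
    congr 1
    ext i
    simp
  refine ⟨U * D, fun i => e i ^ 2, ?_, ?_⟩
  · rw [conjTranspose_mul, hDH, pow_two, hsp]
    calc U * D * Uᴴ * (U * D * Uᴴ) = U * D * (Uᴴ * U) * D * Uᴴ := by simp only [Matrix.mul_assoc]
      _ = _ := by rw [hUU]; simp only [Matrix.mul_assoc, Matrix.one_mul]
  · rw [conjTranspose_mul, hDH]
    calc D * Uᴴ * (U * D) = D * (Uᴴ * U) * D := by simp only [Matrix.mul_assoc]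
      _ = _ := by
        rw [hUU, Matrix.mul_one, hD, diagonal_mul_diagonal]
        congr 1
        ext i
        push_cast
        ring

lemma aux_normsq {n : ℕ} (u : Fin n → ℂ) : ∑ i, ‖u i‖ ^ 2 = (star u ⬝ᵥ u).re := by
  simp only [dotProduct, Complex.re_sum, Pi.star_apply]
  refine Finset.sum_congr rfl fun i _ => ?_
  rw [← Complex.normSq_eq_norm_sq, Complex.normSq_apply]
  simp

/-- `∫_{ℂⁿ} ‖u‖² (1 + u* S⁻² u)^{-p} du = C_{n,p} |det S|² tr(S²)/(p-n-1)`
for a Hermitian positive-definite matrix `S`, where `C_{n,p} = πⁿ (p-n-1)!/(p-1)!`. -/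
theorem integral_normSq_one_add_quadForm_pow_neg
    (n p : ℕ) (hn : 1 ≤ n) (hp : n + 1 < p)
    (S : Matrix (Fin n) (Fin n) ℂ) (hS : S.PosDef) :
    ∫ u : Fin n → ℂ,
        (∑ i, ‖u i‖ ^ 2) * (((1 + (star u ⬝ᵥ ((S ^ 2)⁻¹ *ᵥ u)).re) ^ p)⁻¹ : ℝ)
      = (π ^ n * (Nat.factorial (p - n - 1) : ℝ) / (Nat.factorial (p - 1) : ℝ))
        * ‖S.det‖ ^ 2 * ((S ^ 2).trace.re) / ((p : ℝ) - n - 1) := by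
  obtain ⟨k, rfl⟩ : ∃ k, p = n + k + 2 := ⟨p - n - 2, by omega⟩
  obtain ⟨T, d, h1, h2⟩ := aux_spec S hS
  have hSdet : S.det ≠ 0 := hS.det_pos.ne'
  have hdet : S.det ^ 2 = T.det * star T.det := by
    rw [← det_pow, h1, det_mul, det_conjTranspose]
  have hTdet : T.det ≠ 0 := by
    intro h
    rw [h, zero_mul] at hdet
    exact hSdet (pow_eq_zero_iff two_ne_zero |>.1 hdet)
  have hnorm : ‖T.det‖ ^ 2 = ‖S.det‖ ^ 2 := by
    have := congrArg norm hdet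
    rw [norm_pow, norm_mul, norm_star] at this
    rw [this, pow_two]
  have hTu : IsUnit T.det := isUnit_iff_ne_zero.2 hTdet
  have hTHu : IsUnit Tᴴ.det := by
    rw [det_conjTranspose]; exact hTu.star
  have hinv : Tᴴ * (S ^ 2)⁻¹ * T = 1 := by
    rw [h1, Matrix.mul_inv_rev, ← Matrix.mul_assoc, Matrix.mul_nonsing_inv _ hTHu, Matrix.one_mul,
      Matrix.nonsing_inv_mul _ hTu]
  have htr : (S ^ 2).trace.re = ∑ i, d i := by
    rw [h1, trace_mul_comm, h2, trace_diagonal, Complex.re_sum]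
    simp
  have hq : ∀ v : Fin n → ℂ, (star (T *ᵥ v) ⬝ᵥ ((S ^ 2)⁻¹ *ᵥ (T *ᵥ v))).re = ∑ j, ‖v j‖ ^ 2 := by
    intro v
    rw [star_mulVec, ← dotProduct_mulVec, mulVec_mulVec, mulVec_mulVec, hinv,
      one_mulVec, aux_normsq]
  have hs : ∀ v : Fin n → ℂ, ∑ j, ‖(T *ᵥ v) j‖ ^ 2 = ∑ j, d j * ‖v j‖ ^ 2 := by
    intro v
    rw [aux_normsq, star_mulVec, ← dotProduct_mulVec, mulVec_mulVec, h2]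
    simp only [dotProduct, Complex.re_sum, Pi.star_apply, mulVec_diagonal]
    refine Finset.sum_congr rfl fun i _ => ?_
    rw [← Complex.normSq_eq_norm_sq, Complex.normSq_apply]
    simp
    ring
  rw [aux_cov T hTdet, hnorm, htr]
  simp_rw [hq, hs, Finset.sum_mul, mul_assoc]
  rw [integral_finsetSum _ (fun i _ => (aux_main i k).1.const_mul (d i))]
  simp_rw [integral_const_mul, (aux_main _ k).2]
  rw [← Finset.sum_mul]
  rw [show n + k + 2 - n - 1 = k + 1 by omega, show n + k + 2 - 1 = n + k + 1 by omega,
    Nat.factorial_succ k]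
  have hk : (((n + k + 2 : ℕ) : ℝ) - n - 1) = k + 1 := by push_cast; ring
  rw [hk]
  have : (k : ℝ) + 1 ≠ 0 := by positivity
  push_cast
  field_simp
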